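/- Let P₁,…,P_q be subsets of the vector space Kⁿ over a field K. There exist linearly independent vectors ξ₁ ∈ P₁, …, ξ_q ∈ P_q if and only if for every subset S ⊆ {1,…,q}, dim(∑_{i∈S} span(P_i)) ≥ card(S). -/

import Mathlib

theorem rado_aux {K V ι : Type*} [Field K] [AddCommGroup V] [Module K V] [FiniteDimensional K V]
    [DecidableEq ι] (P : ι → Set V) :
    ∀ (m : ℕ) (I : Finset ι) (W : Submodule K V), I.card = m →
      (∀ S ⊆ I, S.card + Module.finrank K W ≤
        Module.finrank K ↥(W ⊔ ⨆ i ∈ S, Submodule.span K (P i))) →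
      ∃ ξ : ι → V, (∀ i ∈ I, ξ i ∈ P i) ∧
        I.card + Module.finrank K W ≤
          Module.finrank K ↥(W ⊔ Submodule.span K (ξ '' (I : Set ι))) := by
  intro m
  induction m using Nat.strong_induction_on with
  | _ m ih =>
  intro I W hm h
  rcases I.eq_empty_or_nonempty with rfl | hne
  · exact ⟨fun _ => 0, by simp, by
      rw [Finset.card_empty, Nat.zero_add]
      exact Submodule.finrank_mono le_sup_left⟩
  have key : ∃ S ⊆ I, S.Nonempty ∧ ∃ ξ : ι → V, (∀ i ∈ S, ξ i ∈ P i) ∧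
      S.card + Module.finrank K W ≤
        Module.finrank K ↥(W ⊔ Submodule.span K (ξ '' (S : Set ι))) ∧
      ∀ T ⊆ I \ S, T.card + Module.finrank K ↥(W ⊔ Submodule.span K (ξ '' (S : Set ι))) ≤
        Module.finrank K ↥((W ⊔ Submodule.span K (ξ '' (S : Set ι))) ⊔
          ⨆ i ∈ T, Submodule.span K (P i)) := by
    by_cases hc : ∃ S ⊂ I, S.Nonempty ∧
        Module.finrank K ↥(W ⊔ ⨆ i ∈ S, Submodule.span K (P i)) ≤ S.card + Module.finrank K W
    · obtain ⟨S, hSI, hS, ht⟩ := hc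
      obtain ⟨ξ, h1, h2⟩ := ih S.card (hm ▸ Finset.card_lt_card hSI) S W rfl
        (fun T hT => h T (hT.trans hSI.subset))
      have hle : W ⊔ Submodule.span K (ξ '' (S : Set ι)) ≤
          W ⊔ ⨆ i ∈ S, Submodule.span K (P i) := by
        refine sup_le_sup_left ?_ _
        rw [Submodule.span_le]
        rintro _ ⟨i, hi, rfl⟩
        exact (le_iSup₂_of_le (f := fun i (_ : i ∈ S) => Submodule.span K (P i)) i hi le_rfl)
          (Submodule.subset_span (h1 i hi))
      have heq := Submodule.eq_of_le_of_finrank_le hle (ht.trans h2)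
      refine ⟨S, hSI.subset, hS, ξ, h1, h2, fun T hT => ?_⟩
      rw [heq, sup_assoc, ← Finset.iSup_union]
      have := h (S ∪ T) (Finset.union_subset hSI.subset (hT.trans Finset.sdiff_subset))
      rw [Finset.card_union_of_disjoint
        (Finset.disjoint_of_subset_right hT Finset.disjoint_sdiff)] at this
      omega
    · push Not at hc
      obtain ⟨i, hi⟩ := hne
      have hx : ∃ x ∈ P i, x ∉ W := by
        by_contra! hcon
        have := h {i} (by simpa using hi)
        have h3 : W ⊔ ⨆ j ∈ ({i} : Finset ι), Submodule.span K (P j) = W := by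
          simp only [Finset.mem_singleton, iSup_iSup_eq_left, sup_eq_left, Submodule.span_le]
          exact hcon
        rw [h3] at this
        simp at this
      obtain ⟨x, hxP, hxW⟩ := hx
      have hlt : Module.finrank K W < Module.finrank K ↥(W ⊔ Submodule.span K {x}) := by
        apply Submodule.finrank_lt_finrank_of_lt
        refine lt_of_le_of_ne le_sup_left fun he => hxW ?_
        rw [he]
        exact Submodule.mem_sup_right (Submodule.mem_span_singleton_self x)
      have hle : Module.finrank K ↥(W ⊔ Submodule.span K {x}) ≤ Module.finrank K W + 1 :=
        (Submodule.finrank_add_le_finrank_add_finrank _ _).trans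
          (Nat.add_le_add_left ((finrank_span_le_card (R := K) ({x} : Set V)).trans (by simp)) _)
      have him : (fun _ : ι => x) '' (({i} : Finset ι) : Set ι) = {x} := by simp
      refine ⟨{i}, by simpa using hi, by simp, fun _ => x, by simpa using hxP, ?_, ?_⟩
      · rw [him, Finset.card_singleton]; omega
      · intro T hT
        rw [him]
        rcases T.eq_empty_or_nonempty with rfl | hTn
        · rw [Finset.card_empty, Nat.zero_add]
          exact Submodule.finrank_mono le_sup_left
        have hTI : T ⊂ I := lt_of_le_of_lt hT
          (Finset.sdiff_ssubset (by simpa using hi) (by simp))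
        have h4 := hc T hTI hTn
        have h5 : Module.finrank K ↥(W ⊔ ⨆ i ∈ T, Submodule.span K (P i)) ≤
            Module.finrank K ↥((W ⊔ Submodule.span K {x}) ⊔ ⨆ i ∈ T, Submodule.span K (P i)) :=
          Submodule.finrank_mono (sup_le_sup_right le_sup_left _)
        omega
  obtain ⟨S, hSI, hS, ξ, h1, h2, h3⟩ := key
  obtain ⟨η, h4, h5⟩ := ih (I \ S).card
    (hm ▸ Finset.card_lt_card (Finset.sdiff_ssubset hSI hS)) (I \ S) _ rfl h3
  refine ⟨fun i => if i ∈ S then ξ i else η i, fun i hi => ?_, ?_⟩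
  · dsimp only
    split_ifs with hiS
    · exact h1 i hiS
    · exact h4 i (by simp [hi, hiS])
  · have hc := Finset.card_sdiff_add_card_eq_card hSI
    have : Module.finrank K ↥((W ⊔ Submodule.span K (ξ '' (S : Set ι))) ⊔
        Submodule.span K (η '' ((I \ S : Finset ι) : Set ι))) ≤
        Module.finrank K ↥(W ⊔ Submodule.span K
          ((fun i => if i ∈ S then ξ i else η i) '' (I : Set ι))) := by
      apply Submodule.finrank_mono
      rw [sup_assoc, ← Submodule.span_union]
      refine sup_le_sup_left (Submodule.span_mono ?_) _
      rintro _ (⟨i, hi, rfl⟩ | ⟨i, hi, rfl⟩)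
      · exact ⟨i, hSI hi, if_pos hi⟩
      · have hi' := Finset.mem_sdiff.1 (Finset.mem_coe.1 hi)
        exact ⟨i, hi'.1, if_neg hi'.2⟩
    omega

/-- Rado's theorem in terms of dimensions of spans. -/
theorem rado_dim {K : Type*} [Field K] (n q : ℕ) (P : Fin q → Set (Fin n → K)) :
    (∃ ξ : Fin q → (Fin n → K), (∀ i, ξ i ∈ P i) ∧ LinearIndependent K ξ) ↔
      ∀ S : Finset (Fin q),
        S.card ≤ Module.finrank K ↥(⨆ i ∈ S, Submodule.span K (P i)) := by
  constructor
  · rintro ⟨ξ, h1, h2⟩ S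
    have h3 : LinearIndependent K (fun i : S => ξ i) := h2.comp _ Subtype.val_injective
    have h4 := finrank_span_eq_card h3
    rw [Fintype.card_coe] at h4
    rw [← h4]
    apply Submodule.finrank_mono
    rw [Submodule.span_le]
    rintro _ ⟨i, rfl⟩
    exact (le_iSup₂_of_le (f := fun i (_ : i ∈ S) => Submodule.span K (P i)) i.1 i.2 le_rfl)
      (Submodule.subset_span (h1 i))
  · intro h
    obtain ⟨ξ, h1, h2⟩ := rado_aux P _ Finset.univ (⊥ : Submodule K (Fin n → K)) rfl
      (fun S _ => by rw [bot_sup_eq, finrank_bot]; exact h S)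
    refine ⟨ξ, fun i => h1 i (Finset.mem_univ i), ?_⟩
    rw [linearIndependent_iff_card_le_finrank_span]
    rw [bot_sup_eq, finrank_bot, Finset.coe_univ, Set.image_univ] at h2
    exact h2
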